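/- Let 1 < R_0 ≤ +∞, let f_1 be a meromorphic function on 𝔸(R_0), let a_1, a_2, a_3 be pairwise distinct meromorphic functions on 𝔸(R_0) (none identically ∞) with f_1 ≢ a_i for i = 1,2,3, and set f_2 = ((f_1 − a_1)/(f_1 − a_2)) · ((a_3 − a_2)/(a_3 − a_1)). Then N̄_0(r, ν^0_{f_2}) + N̄_0(r, ν^0_{f_2 − 1}) + N̄_0(r, ν^∞_{f_2}) ≤ Σ_{i=1}^{3} ( N̄_0(r, ν^0_{f_1 − a_i}) + 3·T_0(r, a_i) ) + O(1) for 1 ≤ r < R_0. -/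

import Mathlib

open Set MeasureTheory Filter intervalIntegral
open scoped ENNReal Topology BigOperators Classical

noncomputable section

/-- The annulus `𝔸(R₀) = {z : ℂ | 1/R₀ < |z| < R₀}` for `1 < R₀ ≤ ∞`. -/
def Annulus (R0 : ℝ≥0∞) : Set ℂ :=
  {z : ℂ | R0⁻¹ < (‖z‖₊ : ℝ≥0∞) ∧ (‖z‖₊ : ℝ≥0∞) < R0}

/-- Truncation of an integer multiplicity by a level `M ∈ ℕ ∪ {∞}`. -/
def trunc (M : ℕ∞) (n : ℤ) : ℤ :=
  if M = ⊤ then n else min ((M.untopD 0 : ℕ) : ℤ) n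

/-- The (signed) local order of a meromorphic function at a point:
`divisorAt f z` is the order of vanishing of `f` at `z` (negative at poles),
with the junk value `0` if `f` is not meromorphic at `z` or `f ≡ 0` near `z`. -/
def divisorAt (f : ℂ → ℂ) (z : ℂ) : ℤ :=
  if h : MeromorphicAt f z then (meromorphicOrderAt f z).untopD 0 else 0

/-- The divisor of zeros `ν⁰_f`. -/
def zeroDiv (f : ℂ → ℂ) (z : ℂ) : ℤ := max 0 (divisorAt f z)

/-- The divisor of poles `ν^∞_f`. -/
def poleDiv (f : ℂ → ℂ) (z : ℂ) : ℤ := max 0 (-(divisorAt f z))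

/-- The unintegrated counting function `n₀^{[M]}(t)` of a divisor `ν`,
truncated at level `M`. -/
def n0 (M : ℕ∞) (ν : ℂ → ℤ) (t : ℝ) : ℝ :=
  if 1 ≤ t then ∑ᶠ z ∈ {z : ℂ | 1 ≤ ‖z‖ ∧ ‖z‖ ≤ t}, (trunc M (ν z) : ℝ)
  else ∑ᶠ z ∈ {z : ℂ | t ≤ ‖z‖ ∧ ‖z‖ < 1}, (trunc M (ν z) : ℝ)

/-- The integrated counting function `N₀^{[M]}(r, ν)` on the annulus. -/
def N0 (M : ℕ∞) (ν : ℂ → ℤ) (r : ℝ) : ℝ :=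
  (∫ t in (1/r)..1, n0 M ν t / t) + ∫ t in (1:ℝ)..r, n0 M ν t / t

/-- `log⁺ x = max 0 (log x)`. -/
def logPos (x : ℝ) : ℝ := max 0 (Real.log x)

/-- The average of `log⁺ |f|` over the circle of radius `t`. -/
def circleAvg (f : ℂ → ℂ) (t : ℝ) : ℝ :=
  (1 / (2 * Real.pi)) * ∫ θ in (0:ℝ)..(2 * Real.pi),
    logPos ‖f ((t : ℂ) * Complex.exp (θ * Complex.I))‖

/-- The proximity function `m₀(r, f)` on the annulus. -/
def m0 (f : ℂ → ℂ) (r : ℝ) : ℝ :=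
  circleAvg f r + circleAvg f (1/r) - 2 * circleAvg f 1

/-- The Nevanlinna characteristic `T₀(r, f)` on the annulus. -/
def T0 (f : ℂ → ℂ) (r : ℝ) : ℝ := m0 f r + N0 ⊤ (poleDiv f) r

/-- `S` is a small term `S_f(r)` with respect to `f` (for the parameter `λ = lam ≥ 0`):
it is `O(log (r T₀(r,f)))` (resp. `O(log (T₀(r,f)/(R₀ - r)))`) for `r` outside an
exceptional set `Δ` with `∫_Δ r^{λ-1} dr < ∞` (resp. `∫_Δ (R₀-r)^{-λ-1} dr < ∞`). -/
def IsSmallTerm (R0 : ℝ≥0∞) (lam : ℝ) (f : ℂ → ℂ) (S : ℝ → ℝ) : Prop :=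
  if R0 = ⊤ then
    ∃ (Δ : Set ℝ) (C : ℝ), Δ ⊆ Set.Ici 1 ∧
      (∫⁻ r in Δ, ENNReal.ofReal (r ^ (lam - 1))) < ⊤ ∧
      ∀ r ∈ Set.Ici (1:ℝ) \ Δ, |S r| ≤ C * (1 + |Real.log (r * T0 f r)|)
  else
    ∃ (Δ : Set ℝ) (C : ℝ), Δ ⊆ Set.Ico 1 R0.toReal ∧
      (∫⁻ r in Δ, ENNReal.ofReal ((R0.toReal - r) ^ (-(lam + 1)))) < ⊤ ∧
      ∀ r ∈ Set.Ico (1:ℝ) R0.toReal \ Δ,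
        |S r| ≤ C * (1 + |Real.log (T0 f r / (R0.toReal - r))|)

/-- A function is nonconstant on a set. -/
def NonconstantOn (f : ℂ → ℂ) (U : Set ℂ) : Prop :=
  ¬ ∃ c : ℂ, Set.EqOn f (fun _ => c) U

/-- A meromorphic function on the annulus `𝔸(R₀)` is admissible if
`limsup T₀(r,f)/log r = ∞` (when `R₀ = ∞`), resp.
`limsup T₀(r,f)/(-log (R₀ - r)) = ∞` (when `R₀ < ∞`). -/
def Admissible (R0 : ℝ≥0∞) (f : ℂ → ℂ) : Prop :=
  if R0 = ⊤ then ∀ C : ℝ, ∃ᶠ r in atTop, C < T0 f r / Real.log r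
  else ∀ C : ℝ, ∃ᶠ r in 𝓝[<] R0.toReal, C < T0 f r / (-Real.log (R0.toReal - r))

/-- `f` and `g` share the finite set `{a i}` with multiplicity truncated to level `l`. -/
def ShareTrunc (R0 : ℝ≥0∞) (l : ℕ∞) {q : ℕ} (a : Fin q → ℂ) (f g : ℂ → ℂ) : Prop :=
  ∀ z ∈ Annulus R0, (∑ i, trunc l (zeroDiv (fun w => f w - a i) z))
    = ∑ i, trunc l (zeroDiv (fun w => g w - a i) z)

/-- `P` is a uniqueness polynomial for admissible meromorphic functions on `𝔸(R₀)`. -/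
def UniquenessPolynomial (R0 : ℝ≥0∞) (P : Polynomial ℂ) : Prop :=
  ∀ f g : ℂ → ℂ, MeromorphicOn f (Annulus R0) → MeromorphicOn g (Annulus R0) →
    NonconstantOn f (Annulus R0) → NonconstantOn g (Annulus R0) →
    Admissible R0 f → Admissible R0 g →
    ∀ c : ℂ, c ≠ 0 →
      Set.EqOn (fun z => P.eval (f z)) (fun z => c * P.eval (g z)) (Annulus R0) →
      Set.EqOn f g (Annulus R0)

/-- Meromorphy of a target which is possibly `≡ ∞` (encoded by `none`). -/
def TargetMeromorphic (U : Set ℂ) : Option (ℂ → ℂ) → Prop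
  | none => True
  | some a => MeromorphicOn a U

/-- Two targets (possibly `≡ ∞`) are distinct (as meromorphic functions on `U`). -/
def TargetNe (U : Set ℂ) : Option (ℂ → ℂ) → Option (ℂ → ℂ) → Prop
  | none, none => False
  | none, some _ => True
  | some _, none => True
  | some a, some b => ¬ Set.EqOn a b U

/-- The divisor `ν⁰_{g - a}`, interpreted as `ν^∞_g` when `a ≡ ∞`. -/
def targetZeroDiv (g : ℂ → ℂ) : Option (ℂ → ℂ) → ℂ → ℤ
  | none => poleDiv g
  | some a => zeroDiv (fun z => g z - a z)

/-- The characteristic `T₀(r, a)` of a target, set to `0` when `a ≡ ∞`. -/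
def targetT0 : Option (ℂ → ℂ) → ℝ → ℝ
  | none => fun _ => 0
  | some a => T0 a

/-- A small term with respect to a target, taken `≡ 0` when the target is `≡ ∞`. -/
def TargetSmall (R0 : ℝ≥0∞) (lam : ℝ) : Option (ℂ → ℂ) → (ℝ → ℝ) → Prop
  | none => fun S => S = fun _ => 0
  | some a => IsSmallTerm R0 lam a


/-- The closed annulus. -/
def KK (ρ : ℝ) : Set ℂ := {z : ℂ | 1/ρ ≤ ‖z‖ ∧ ‖z‖ ≤ ρ}

lemma hasDerivAt_log_norm {w : ℝ → ℂ} {w' : ℂ} {s : ℝ} (hw : HasDerivAt w w' s)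
    (h0 : w s ≠ 0) : HasDerivAt (fun x => Real.log ‖w x‖) (w' / w s).re s := by
  have h1 : HasDerivAt (fun x => w x / w s) (w' / w s) s := hw.div_const _
  have h2 : HasDerivAt (fun x => Complex.log (w x / w s)) (w' / w s) s := by
    have := h1.clog_real (by rw [div_self h0]; simp)
    rwa [div_self h0, div_one] at this
  have h3 : HasDerivAt (fun x => (Complex.log (w x / w s)).re) (w' / w s).re s := by
    have := (Complex.reCLM.hasFDerivAt (x := Complex.log (w s / w s))).comp_hasDerivAt s h2
    exact this
  have h4 := h3.const_add (Real.log ‖w s‖)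
  refine h4.congr_of_eventuallyEq ?_
  filter_upwards [hw.continuousAt.eventually_ne h0] with x hx
  rw [Complex.log_re, norm_div, Real.log_div (norm_ne_zero_iff.2 hx) (norm_ne_zero_iff.2 h0)]
  ring

lemma harm {ρ : ℝ} (hρ : 1 < ρ) {h : ℂ → ℂ} (ha : AnalyticOnNhd ℂ h (KK ρ))
    (h0 : ∀ z ∈ KK ρ, h z ≠ 0) {r : ℝ} (hr : 1 ≤ r) (hrρ : r < ρ) :
    Real.circleAverage (fun z => Real.log ‖h z‖) 0 r
      + Real.circleAverage (fun z => Real.log ‖h z‖) 0 (1/r)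
      = 2 * Real.circleAverage (fun z => Real.log ‖h z‖) 0 1 := by
  set L := Real.log ρ with hL
  have hρ0 : 0 < ρ := by linarith
  have hmemK : ∀ s ∈ Icc (-L) L, ∀ θ : ℝ, circleMap 0 (Real.exp s) θ ∈ KK ρ := by
    intro s hs θ
    simp only [KK, mem_ofPred_eq, norm_circleMap_zero, abs_of_pos (Real.exp_pos s)]
    constructor
    · rw [one_div, ← Real.exp_log hρ0, ← Real.exp_neg]
      exact Real.exp_le_exp.2 hs.1
    · rw [← Real.exp_log hρ0]
      exact Real.exp_le_exp.2 hs.2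
  have hKc : IsCompact (KK ρ) := by
    refine Metric.isCompact_of_isClosed_isBounded ?_ ?_
    · exact (isClosed_le continuous_const continuous_norm).inter
        (isClosed_le continuous_norm continuous_const)
    · refine (Metric.isBounded_closedBall (x := (0:ℂ)) (r := ρ)).subset ?_
      intro z hz
      simpa using hz.2
  set F : ℂ → ℂ := fun z => deriv h z / h z with hF
  have hFc : ContinuousOn F (KK ρ) := (ha.deriv.continuousOn).div ha.continuousOn h0
  obtain ⟨M, hM⟩ := hKc.exists_bound_of_continuousOn (continuousOn_id.mul hFc)
  set V : ℝ → ℝ := fun s => ∫ θ in (0:ℝ)..(2*Real.pi), Real.log ‖h (circleMap 0 (Real.exp s) θ)‖ with hV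
  have hcm : ∀ θ s : ℝ, HasDerivAt (fun s : ℝ => circleMap 0 (Real.exp s) θ)
      (circleMap 0 (Real.exp s) θ) s := by
    intro θ s
    simp only [circleMap, zero_add]
    exact ((Real.hasDerivAt_exp s).ofReal_comp).mul_const _
  have hcmc : ∀ s, Continuous (circleMap 0 (Real.exp s)) := fun s => continuous_circleMap _ _
  have hVd : ∀ s ∈ Ioo (-L) L, HasDerivAt V
      (∫ θ in (0:ℝ)..(2*Real.pi), (circleMap 0 (Real.exp s) θ * F (circleMap 0 (Real.exp s) θ)).re) s := by
    intro s hs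
    refine (intervalIntegral.hasDerivAt_integral_of_dominated_loc_of_deriv_le
      (F := fun s θ => Real.log ‖h (circleMap 0 (Real.exp s) θ)‖)
      (F' := fun s θ => (circleMap 0 (Real.exp s) θ * F (circleMap 0 (Real.exp s) θ)).re)
      (bound := fun _ => M) (Ioo_mem_nhds hs.1 hs.2) ?_ ?_ ?_ ?_ ?_ ?_).2
    · filter_upwards [Ioo_mem_nhds hs.1 hs.2] with x hx
      apply Continuous.aestronglyMeasurable
      have : Continuous fun θ => h (circleMap 0 (Real.exp x) θ) :=
        ha.continuousOn.comp_continuous (hcmc x) (hmemK x (Ioo_subset_Icc_self hx))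
      exact this.norm.log (fun θ => norm_ne_zero_iff.2 (h0 _ (hmemK x (Ioo_subset_Icc_self hx) θ)))
    · apply Continuous.intervalIntegrable
      have : Continuous fun θ => h (circleMap 0 (Real.exp s) θ) :=
        ha.continuousOn.comp_continuous (hcmc s) (hmemK s (Ioo_subset_Icc_self hs))
      exact this.norm.log (fun θ => norm_ne_zero_iff.2 (h0 _ (hmemK s (Ioo_subset_Icc_self hs) θ)))
    · apply Continuous.aestronglyMeasurable
      exact Complex.continuous_re.comp ((hcmc s).mul
        (hFc.comp_continuous (hcmc s) (hmemK s (Ioo_subset_Icc_self hs))))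
    · refine Eventually.of_forall fun θ _ x hx => ?_
      exact (Complex.abs_re_le_norm _).trans (hM _ (hmemK x (Ioo_subset_Icc_self hx) θ))
    · simp
    · refine Eventually.of_forall fun θ _ x hx => ?_
      have hm := hmemK x (Ioo_subset_Icc_self hx) θ
      have h1 : HasDerivAt (fun s : ℝ => h (circleMap 0 (Real.exp s) θ))
          (deriv h (circleMap 0 (Real.exp x) θ) * circleMap 0 (Real.exp x) θ) x :=
        (ha _ hm).differentiableAt.hasDerivAt.comp x (hcm θ x)
      have := hasDerivAt_log_norm h1 (h0 _ hm)
      have he : deriv h (circleMap 0 (Real.exp x) θ) * circleMap 0 (Real.exp x) θ /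
          h (circleMap 0 (Real.exp x) θ)
          = circleMap 0 (Real.exp x) θ * F (circleMap 0 (Real.exp x) θ) := by
        simp only [F]; ring
      rw [he] at this
      exact this
  have hconst : ∀ s ∈ Ioo (-L) L, ∀ s' ∈ Ioo (-L) L, s ≤ s' →
      (∫ θ in (0:ℝ)..(2*Real.pi), (circleMap 0 (Real.exp s) θ * F (circleMap 0 (Real.exp s) θ)).re) =
      ∫ θ in (0:ℝ)..(2*Real.pi), (circleMap 0 (Real.exp s') θ * F (circleMap 0 (Real.exp s') θ)).re := by
    intro s hs s' hs' hss
    have key : ∀ x ∈ Ioo (-L) L,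
      (∫ θ in (0:ℝ)..(2*Real.pi), (circleMap 0 (Real.exp x) θ * F (circleMap 0 (Real.exp x) θ)).re)
       = (-Complex.I * ∮ z in C(0, Real.exp x), F z).re := by
      intro x hx
      have hc : Continuous fun θ => circleMap 0 (Real.exp x) θ * F (circleMap 0 (Real.exp x) θ) :=
        (hcmc x).mul (hFc.comp_continuous (hcmc x) (hmemK x (Ioo_subset_Icc_self hx)))
      have h1 := Complex.reCLM.intervalIntegral_comp_comm (hc.intervalIntegrable (μ := volume) 0 (2*Real.pi))
      simp only [Complex.reCLM_apply] at h1
      rw [h1, circleIntegral, ← intervalIntegral.integral_const_mul]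
      congr 1
      apply intervalIntegral.integral_congr
      intro θ _
      simp only [deriv_circleMap, smul_eq_mul]
      linear_combination ((circleMap 0 (Real.exp x) θ * F (circleMap 0 (Real.exp x) θ))) * Complex.I_mul_I
    rw [key s hs, key s' hs']
    have hsub : Metric.closedBall (0:ℂ) (Real.exp s') \ Metric.ball 0 (Real.exp s) ⊆ KK ρ := by
      intro z hz
      simp only [Set.mem_sdiff, Metric.mem_closedBall, dist_zero_right, Metric.mem_ball, not_lt] at hz
      constructor
      · refine le_trans ?_ hz.2
        rw [one_div, ← Real.exp_log hρ0, ← Real.exp_neg]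
        exact Real.exp_le_exp.2 hs.1.le
      · refine le_trans hz.1 ?_
        rw [← Real.exp_log hρ0]
        exact Real.exp_le_exp.2 hs'.2.le
    rw [Complex.circleIntegral_eq_of_differentiable_on_annulus_off_countable (Real.exp_pos s)
      (Real.exp_le_exp.2 hss) countable_empty (hFc.mono hsub)]
    intro z hz
    have hzK : z ∈ KK ρ := hsub ⟨Metric.ball_subset_closedBall hz.1.1,
      fun hh => hz.1.2 (Metric.ball_subset_closedBall hh)⟩
    exact (ha.deriv z hzK).differentiableAt.div (ha z hzK).differentiableAt (h0 z hzK)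
  have hr0 : 0 < r := by linarith
  have hlr : 0 ≤ Real.log r := Real.log_nonneg hr
  have hlL : Real.log r < L := Real.log_lt_log hr0 hrρ
  have hW : V (Real.log r) + V (-Real.log r) = V 0 + V (-0) := by
    have hd : ∀ x ∈ Icc 0 (Real.log r), HasDerivAt (fun x => V x + V (-x)) 0 x := by
      intro x hx
      have h1 : x ∈ Ioo (-L) L := ⟨by linarith [hx.1], by linarith [hx.2]⟩
      have h2 : -x ∈ Ioo (-L) L := ⟨by linarith [hx.2], by linarith [hx.1]⟩
      have h3 := (hVd x h1).add ((hVd (-x) h2).comp x (hasDerivAt_neg x))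
      rw [hconst (-x) h2 x h1 (by linarith [hx.1])] at h3
      rw [mul_neg_one, add_neg_cancel] at h3
      exact h3
    exact constant_of_has_deriv_right_zero (f := fun x => V x + V (-x))
      (fun x hx => (hd x hx).continuousAt.continuousWithinAt)
      (fun x hx => (hd x (Ico_subset_Icc_self hx)).hasDerivWithinAt) (Real.log r)
      (right_mem_Icc.2 hlr)
  have e1 : Real.circleAverage (fun z => Real.log ‖h z‖) 0 r = (2*Real.pi)⁻¹ * V (Real.log r) := by
    simp [Real.circleAverage, hV, Real.exp_log hr0]
  have e2 : Real.circleAverage (fun z => Real.log ‖h z‖) 0 (1/r) = (2*Real.pi)⁻¹ * V (-Real.log r) := by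
    simp [Real.circleAverage, hV, Real.exp_neg, Real.exp_log hr0]
  have e3 : Real.circleAverage (fun z => Real.log ‖h z‖) 0 1 = (2*Real.pi)⁻¹ * V 0 := by
    simp [Real.circleAverage, hV]
  rw [e1, e2, e3, ← mul_add, hW, neg_zero]
  ring

lemma isCompact_KK (ρ : ℝ) : IsCompact (KK ρ) := by
  refine Metric.isCompact_of_isClosed_isBounded ?_ ?_
  · exact (isClosed_le continuous_const continuous_norm).inter
      (isClosed_le continuous_norm continuous_const)
  · refine (Metric.isBounded_closedBall (x := (0:ℂ)) (r := ρ)).subset ?_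
    intro z hz
    simpa using hz.2

/-- Kernel. -/
def kern (r : ℝ) (u : ℂ) : ℝ := max 0 (Real.log r - |Real.log ‖u‖|)

lemma kern_nonneg (r : ℝ) (u : ℂ) : 0 ≤ kern r u := le_max_left _ _

lemma divisorAt_eq (g : ℂ → ℂ) (z : ℂ) (h : MeromorphicAt g z) :
    divisorAt g z = (meromorphicOrderAt g z).untopD 0 := by
  simp [divisorAt, h]

lemma divisor_eq {g : ℂ → ℂ} {U : Set ℂ} (hg : MeromorphicOn g U) {z : ℂ} (hz : z ∈ U) :
    MeromorphicOn.divisor g U z = divisorAt g z := by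
  rw [MeromorphicOn.divisor_apply hg hz, divisorAt_eq g z (hg z hz)]
  rfl

lemma finite_div {g : ℂ → ℂ} {ρ : ℝ} (hg : MeromorphicOn g (KK ρ)) :
    {z | z ∈ KK ρ ∧ divisorAt g z ≠ 0}.Finite := by
  refine ((MeromorphicOn.divisor g (KK ρ)).finiteSupport (isCompact_KK ρ)).subset ?_
  rintro z ⟨hz, h⟩
  rw [Function.mem_support, divisor_eq hg hz]
  exact h

lemma max_id (L a : ℝ) (hL : 0 ≤ L) :
    max L a + max (-L) a - 2 * max 0 a = max 0 (L - |a|) := by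
  rcases le_total 0 a with h | h
  · rw [abs_of_nonneg h, max_eq_right h, max_eq_right (by linarith : -L ≤ a)]
    rcases le_total L a with h' | h'
    · rw [max_eq_right h', max_eq_left (by linarith)]; ring
    · rw [max_eq_left h', max_eq_right (by linarith)]; ring
  · rw [abs_of_nonpos h, max_eq_left h, max_eq_left (by linarith : a ≤ L)]
    rcases le_total (-L) a with h' | h'
    · rw [max_eq_right h', max_eq_right (by linarith)]; ring
    · rw [max_eq_left h', max_eq_left (by linarith)]; ring

lemma avg_max {t : ℝ} (ht : 0 < t) {u : ℂ} (hu : u ≠ 0) :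
    Real.circleAverage (fun z => Real.log ‖z - u‖) 0 t = max (Real.log t) (Real.log ‖u‖) := by
  rw [circleAverage_log_norm_sub_const_eq_log_radius_add_posLog ht.ne', Real.posLog_apply,
    zero_sub, norm_neg, Real.log_mul (inv_ne_zero ht.ne') (norm_ne_zero_iff.2 hu), Real.log_inv,
    ← max_add_add_left]
  simp

lemma jensen {ρ : ℝ} (hρ : 1 < ρ) {g : ℂ → ℂ} (hg : MeromorphicOn g (KK ρ))
    (hne : ∀ u ∈ KK ρ, meromorphicOrderAt g u ≠ ⊤) {r : ℝ} (hr : 1 ≤ r) (hrρ : r < ρ)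
    (F : Finset ℂ) (hF : ∀ z ∈ F, z ∈ KK ρ) (hF' : ∀ z ∈ KK ρ, z ∉ F → divisorAt g z = 0) :
    Real.circleAverage (fun z => Real.log ‖g z‖) 0 r
      + Real.circleAverage (fun z => Real.log ‖g z‖) 0 (1/r)
      - 2 * Real.circleAverage (fun z => Real.log ‖g z‖) 0 1
      = ∑ u ∈ F, (divisorAt g u : ℝ) * kern r u := by
  have hρ0 : 0 < ρ := by linarith
  have hr0 : 0 < r := by linarith
  obtain ⟨h, h1, h2, h3⟩ := hg.extract_zeros_poles (fun u => hne u u.2)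
    ((MeromorphicOn.divisor g (KK ρ)).finiteSupport (isCompact_KK ρ))
  have h4 := MeromorphicOn.extract_zeros_poles_log h2 h3
  have hsum : (∑ᶠ u, ((MeromorphicOn.divisor g (KK ρ) u : ℝ) * Real.log ‖· - u‖))
      = ∑ u ∈ F, fun z => (divisorAt g u : ℝ) * Real.log ‖z - u‖ := by
    rw [finsum_eq_sum_of_support_subset (s := F)]
    · refine Finset.sum_congr rfl fun u hu => ?_
      rw [divisor_eq hg (hF u hu)]
    · intro u hu
      by_contra hcon
      apply hu
      have : MeromorphicOn.divisor g (KK ρ) u = 0 := by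
        by_cases huK : u ∈ KK ρ
        · rw [divisor_eq hg huK, hF' u huK hcon]
        · exact Function.locallyFinsuppWithin.apply_eq_zero_of_notMem _ huK
      ext z
      simp [this]
  rw [hsum] at h4
  have hu0 : ∀ u ∈ F, u ≠ 0 := by
    intro u hu h0
    have := (hF u hu).1
    rw [h0, norm_zero] at this
    have : 0 < 1 / ρ := by positivity
    linarith
  have hA : ∀ t : ℝ, 1/ρ ≤ t → t ≤ ρ → Real.circleAverage (fun z => Real.log ‖g z‖) 0 t
      = ∑ u ∈ F, (divisorAt g u : ℝ) * max (Real.log t) (Real.log ‖u‖)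
        + Real.circleAverage (fun z => Real.log ‖h z‖) 0 t := by
    intro t ht1 ht2
    have ht0 : 0 < t := lt_of_lt_of_le (by positivity) ht1
    have hsub : Metric.sphere (0:ℂ) |t| ⊆ KK ρ := by
      intro z hz
      rw [mem_sphere_zero_iff_norm, abs_of_pos ht0] at hz
      exact ⟨hz ▸ ht1, hz ▸ ht2⟩
    have hi : ∀ u ∈ F, CircleIntegrable (fun z => (divisorAt g u : ℝ) * Real.log ‖z - u‖) 0 t := by
      intro u hu
      apply IntervalIntegrable.const_mul
      apply (analyticOnNhd_id.sub analyticOnNhd_const).meromorphicOn.circleIntegrable_log_norm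
    rw [Real.circleAverage_congr_codiscreteWithin (codiscreteWithin_mono hsub h4) ht0.ne',
      Real.circleAverage_add (CircleIntegrable.sum F hi)
        ((h1.mono hsub).meromorphicOn.circleIntegrable_log_norm), Real.circleAverage_sum hi]
    congr 1
    refine Finset.sum_congr rfl fun u hu => ?_
    rw [← avg_max ht0 (hu0 u hu)]
    simp_rw [← smul_eq_mul, Real.circleAverage_fun_smul]
  have hr1 : 1/ρ ≤ r := by
    rw [div_le_iff₀ hρ0]; nlinarith
  rw [hA r hr1 hrρ.le, hA (1/r) (one_div_le_one_div_of_le hr0 hrρ.le)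
    (by rw [div_le_iff₀ hr0]; nlinarith), hA 1 (by rw [div_le_iff₀ hρ0]; linarith) hρ.le]
  have hh := harm hρ h1 (fun z hz => h2 ⟨z, hz⟩) hr hrρ
  have hk : ∑ u ∈ F, (divisorAt g u : ℝ) * kern r u
      = ∑ u ∈ F, (divisorAt g u : ℝ) * max (Real.log r) (Real.log ‖u‖)
      + ∑ u ∈ F, (divisorAt g u : ℝ) * max (Real.log (1/r)) (Real.log ‖u‖)
      - 2 * ∑ u ∈ F, (divisorAt g u : ℝ) * max (Real.log 1) (Real.log ‖u‖) := by
    rw [Finset.mul_sum, ← Finset.sum_add_distrib, ← Finset.sum_sub_distrib]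
    refine Finset.sum_congr rfl fun u hu => ?_
    rw [kern, ← max_id _ _ (Real.log_nonneg hr), one_div, Real.log_inv, Real.log_one]
    ring
  rw [hk]
  linarith

lemma piece {f : ℝ → ℝ} {a b c : ℝ} (h : 0 < a) (hab : a ≤ b) (hf : ∀ t ∈ Ioo a b, f t = c / t) :
    IntervalIntegrable f volume a b ∧ ∫ t in a..b, f t = c * (Real.log b - Real.log a) := by
  have hb : 0 < b := by linarith
  have h0 : (0:ℝ) ∉ uIcc a b := by
    rw [uIcc_of_le hab]
    intro hh
    linarith [hh.1]
  constructor
  · have h1 : IntervalIntegrable (fun t : ℝ => c * t⁻¹) volume a b :=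
      (intervalIntegral.intervalIntegrable_inv (fun x hx hx0 => h0 (hx0 ▸ hx))
        continuousOn_id).const_mul c
    refine h1.congr_uIoo ?_
    intro t ht
    rw [uIoo_of_le hab] at ht
    simp only [hf t ht]; ring
  · rw [intervalIntegral.integral_congr_Ioo_of_le hab (g := fun t => c * t⁻¹)
      (fun t ht => by simp only [hf t ht]; ring),
      intervalIntegral.integral_const_mul, integral_inv h0, Real.log_div hb.ne' h.ne']

lemma piece2 {f : ℝ → ℝ} {a b d c1 c2 : ℝ} (h : 0 < a) (hab : a ≤ b) (hbd : b ≤ d)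
    (hf : ∀ t ∈ Ioo a b, f t = c1 / t) (hf2 : ∀ t ∈ Ioo b d, f t = c2 / t) :
    IntervalIntegrable f volume a d ∧
    ∫ t in a..d, f t = c1 * (Real.log b - Real.log a) + c2 * (Real.log d - Real.log b) := by
  obtain ⟨h1, h2⟩ := piece h hab hf
  obtain ⟨h3, h4⟩ := piece (by linarith) hbd hf2
  exact ⟨h1.trans h3, by rw [← intervalIntegral.integral_add_adjacent_intervals h1 h3, h2, h4]⟩

lemma int1 {r a : ℝ} (hr : 1 ≤ r) :
    IntervalIntegrable (fun t => (if 1 ≤ a ∧ a ≤ t then (1:ℝ) else 0) / t) volume 1 r ∧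
    ∫ t in (1:ℝ)..r, (if 1 ≤ a ∧ a ≤ t then (1:ℝ) else 0) / t
      = if 1 ≤ a then max 0 (Real.log r - Real.log a) else 0 := by
  by_cases h1 : 1 ≤ a
  · by_cases h2 : a ≤ r
    · obtain ⟨p, q⟩ := piece2 (f := fun t => (if 1 ≤ a ∧ a ≤ t then (1:ℝ) else 0) / t)
        (c1 := 0) (c2 := 1) one_pos h1 h2
        (fun t ht => by rw [if_neg]; rintro ⟨_, h⟩; linarith [ht.2])
        (fun t ht => by rw [if_pos ⟨h1, ht.1.le⟩])
      refine ⟨p, q.trans ?_⟩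
      have := Real.log_le_log (by linarith) h2
      rw [if_pos h1, max_eq_right (by linarith)]
      ring
    · push Not at h2
      obtain ⟨p, q⟩ := piece (f := fun t => (if 1 ≤ a ∧ a ≤ t then (1:ℝ) else 0) / t)
        (c := 0) one_pos hr
        (fun t ht => by rw [if_neg]; rintro ⟨_, h⟩; linarith [ht.2])
      refine ⟨p, q.trans ?_⟩
      have := Real.log_le_log (by linarith) h2.le
      rw [if_pos h1, max_eq_left (by linarith)]
      ring
  · simp [h1]

lemma int2 {r a : ℝ} (hr : 1 ≤ r) (ha : 0 < a) :
    IntervalIntegrable (fun t => (if t ≤ a ∧ a < 1 then (1:ℝ) else 0) / t) volume (1/r) 1 ∧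
    ∫ t in (1/r)..(1:ℝ), (if t ≤ a ∧ a < 1 then (1:ℝ) else 0) / t
      = if a < 1 then max 0 (Real.log r + Real.log a) else 0 := by
  have hr0 : 0 < r := by linarith
  have hrr : 0 < 1/r := by positivity
  have hr1 : 1/r ≤ 1 := by rw [div_le_iff₀ hr0]; linarith
  have hl : Real.log (1/r) = -Real.log r := by rw [one_div, Real.log_inv]
  by_cases h1 : a < 1
  · by_cases h2 : 1/r ≤ a
    · obtain ⟨p, q⟩ := piece2 (f := fun t => (if t ≤ a ∧ a < 1 then (1:ℝ) else 0) / t)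
        (c1 := 1) (c2 := 0) hrr h2 h1.le
        (fun t ht => by rw [if_pos ⟨ht.2.le, h1⟩])
        (fun t ht => by rw [if_neg]; rintro ⟨h, _⟩; linarith [ht.1])
      refine ⟨p, q.trans ?_⟩
      have := Real.log_le_log hrr h2
      rw [if_pos h1, max_eq_right (by linarith), hl]
      ring
    · push Not at h2
      obtain ⟨p, q⟩ := piece (f := fun t => (if t ≤ a ∧ a < 1 then (1:ℝ) else 0) / t)
        (c := 0) hrr hr1
        (fun t ht => by rw [if_neg]; rintro ⟨h, _⟩; linarith [ht.1])
      refine ⟨p, q.trans ?_⟩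
      have := Real.log_le_log ha h2.le
      rw [if_pos h1, max_eq_left (by linarith)]
      ring
  · simp [h1]

lemma fsum {S : Set ℂ} {w : ℂ → ℝ} {F : Finset ℂ} (h : ∀ z ∈ S, z ∉ F → w z = 0) :
    ∑ᶠ z ∈ S, w z = ∑ z ∈ F, w z * (if z ∈ S then 1 else 0) := by
  rw [finsum_mem_def, finsum_eq_sum_of_support_subset (s := F)]
  · refine Finset.sum_congr rfl fun z _ => ?_
    by_cases hz : z ∈ S <;> simp [hz]
  · intro z hz
    by_contra hc
    apply hz
    by_cases hS : z ∈ S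
    · simp [hS, h z hS hc]
    · simp [hS]

lemma N0_eq {M : ℕ∞} {ν : ℂ → ℤ} {r : ℝ} (hr : 1 ≤ r) {F : Finset ℂ} (h0 : ∀ z ∈ F, z ≠ 0)
    (h : ∀ z ∈ KK r, z ∉ F → trunc M (ν z) = 0) :
    N0 M ν r = ∑ z ∈ F, (trunc M (ν z) : ℝ) * kern r z := by
  have hr0 : 0 < r := by linarith
  have hrr : 0 < 1/r := by positivity
  have hr1 : 1/r ≤ 1 := by rw [div_le_iff₀ hr0]; linarith
  have e1 : ∫ t in (1:ℝ)..r, n0 M ν t / t =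
      ∑ z ∈ F, (trunc M (ν z) : ℝ) * (if 1 ≤ ‖z‖ then max 0 (Real.log r - Real.log ‖z‖) else 0) := by
    rw [intervalIntegral.integral_congr_Ioo_of_le hr (g := fun t => ∑ z ∈ F,
      (trunc M (ν z) : ℝ) * ((if 1 ≤ ‖z‖ ∧ ‖z‖ ≤ t then (1:ℝ) else 0) / t))]
    · rw [intervalIntegral.integral_finsetSum
        (fun z _ => (int1 (a := ‖z‖) hr).1.const_mul _)]
      refine Finset.sum_congr rfl fun z _ => ?_
      rw [intervalIntegral.integral_const_mul, (int1 hr).2]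
    · intro t ht
      simp only [n0, if_pos ht.1.le]
      rw [fsum (F := F), Finset.sum_div]
      · refine Finset.sum_congr rfl fun z _ => ?_
        simp only [mem_ofPred_eq]
        ring_nf
      · intro z hz hzF
        have := h z ⟨hr1.trans hz.1, hz.2.trans ht.2.le⟩ hzF
        exact_mod_cast this
  have e2 : ∫ t in (1/r)..(1:ℝ), n0 M ν t / t =
      ∑ z ∈ F, (trunc M (ν z) : ℝ) * (if ‖z‖ < 1 then max 0 (Real.log r + Real.log ‖z‖) else 0) := by
    rw [intervalIntegral.integral_congr_Ioo_of_le hr1 (g := fun t => ∑ z ∈ F,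
      (trunc M (ν z) : ℝ) * ((if t ≤ ‖z‖ ∧ ‖z‖ < 1 then (1:ℝ) else 0) / t))]
    · rw [intervalIntegral.integral_finsetSum
        (fun z hz => (int2 (a := ‖z‖) hr (norm_pos_iff.2 (h0 z hz))).1.const_mul _)]
      refine Finset.sum_congr rfl fun z hz => ?_
      rw [intervalIntegral.integral_const_mul, (int2 hr (norm_pos_iff.2 (h0 z hz))).2]
    · intro t ht
      simp only [n0, if_neg (not_le.2 ht.2)]
      rw [fsum (F := F), Finset.sum_div]
      · refine Finset.sum_congr rfl fun z _ => ?_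
        simp only [mem_ofPred_eq]
        ring_nf
      · intro z hz hzF
        have := h z ⟨ht.1.le.trans hz.1, hz.2.le.trans hr⟩ hzF
        exact_mod_cast this
  rw [N0, e1, e2, ← Finset.sum_add_distrib]
  refine Finset.sum_congr rfl fun z hz => ?_
  rw [← mul_add, kern]
  congr 1
  by_cases hz1 : 1 ≤ ‖z‖
  · rw [if_pos hz1, if_neg (not_lt.2 hz1), abs_of_nonneg (Real.log_nonneg hz1), zero_add]
  · have h2 : ‖z‖ < 1 := not_le.1 hz1
    rw [if_neg hz1, if_pos h2, abs_of_nonpos (Real.log_nonpos (norm_nonneg z) h2.le), add_zero,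
      sub_neg_eq_add]

lemma trunc_one (n : ℤ) : trunc 1 n = min 1 n := by
  have h1 : (1 : ℕ∞) ≠ ⊤ := by simp
  rw [trunc, if_neg h1]
  rfl

lemma trunc_top (n : ℤ) : trunc ⊤ n = n := by simp [trunc]

lemma ord_cmul {u : ℂ → ℂ} {z c : ℂ} (hu : MeromorphicAt u z) (hc : c ≠ 0) :
    meromorphicOrderAt (fun x => c * u x) z = meromorphicOrderAt u z := by
  have h := meromorphicOrderAt_mul (MeromorphicAt.const c z) hu
  rw [meromorphicOrderAt_const, if_neg hc, zero_add] at h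
  exact h

lemma ord_add' {u v w : ℂ → ℂ} {z c d : ℂ} (hu : MeromorphicAt u z) (hv : MeromorphicAt v z)
    (hc : c ≠ 0) (hd : d ≠ 0) (hw : ∀ x, w x = c * u x + d * v x) :
    min (meromorphicOrderAt u z) (meromorphicOrderAt v z) ≤ meromorphicOrderAt w z := by
  have h := meromorphicOrderAt_add ((MeromorphicAt.const c z).mul hu)
    ((MeromorphicAt.const d z).mul hv)
  have e1 := ord_cmul hu hc
  have e2 := ord_cmul hv hd
  have e3 : w = (fun x => c * u x) + fun x => d * v x := funext hw
  rw [← e1, ← e2, e3]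
  exact h

lemma ord3 {u v w : ℂ → ℂ} {z c d : ℂ} (hu : MeromorphicAt u z) (hv : MeromorphicAt v z)
    (hc : c ≠ 0) (hd : d ≠ 0) (hw : ∀ x, w x = c * u x + d * v x) {p q s : ℤ}
    (hp : meromorphicOrderAt u z = p) (hq : meromorphicOrderAt v z = q)
    (hs : meromorphicOrderAt w z = s) : min p q ≤ s := by
  have h := ord_add' hu hv hc hd hw
  rw [hp, hq, hs] at h
  exact_mod_cast h

lemma pole_sub {u v : ℂ → ℂ} {z : ℂ} (hu : MeromorphicAt u z) (hv : MeromorphicAt v z) :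
    min 0 (min (divisorAt u z) (divisorAt v z)) ≤ divisorAt (fun x => u x - v x) z := by
  have hw : MeromorphicAt (fun x => u x - v x) z := hu.sub hv
  have h := ord_add' (w := fun x => u x - v x) (c := 1) (d := -1) hu hv one_ne_zero
    (by simp) (fun x => by ring)
  rw [divisorAt_eq _ _ hu, divisorAt_eq _ _ hv, divisorAt_eq _ _ hw]
  generalize meromorphicOrderAt u z = a at *
  generalize meromorphicOrderAt v z = b at *
  generalize meromorphicOrderAt (fun x => u x - v x) z = c at *
  induction c with
  | top => simp
  | coe c =>
    induction a with
    | top =>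
      induction b with
      | top => simp at h
      | coe b =>
        have : b ≤ c := by simpa using h
        simp only [WithTop.untopD_top, WithTop.untopD_coe]
        omega
    | coe a =>
      induction b with
      | top =>
        have : a ≤ c := by simpa using h
        simp only [WithTop.untopD_top, WithTop.untopD_coe]
        omega
      | coe b =>
        have : min a b ≤ c := by exact_mod_cast h
        simp only [WithTop.untopD_coe]
        omega

lemma poleDiv_sub {u v : ℂ → ℂ} {z : ℂ} (hu : MeromorphicAt u z) (hv : MeromorphicAt v z) :
    poleDiv (fun x => u x - v x) z ≤ poleDiv u z + poleDiv v z := by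
  have := pole_sub hu hv
  simp only [poleDiv]
  omega

lemma div_const {f : ℂ → ℂ} {z c : ℂ} (h : f =ᶠ[𝓝[≠] z] fun _ => c) : divisorAt f z = 0 := by
  unfold divisorAt
  split_ifs with hm
  · rw [meromorphicOrderAt_congr h, meromorphicOrderAt_const]
    split_ifs <;> simp
  · rfl

lemma int_core {X Y p1 p2 p3 q12 q31 q32 d1 d2 d3 : ℤ}
    (A1 : min X 0 ≤ Y) (A2 : min Y 0 ≤ X) (A3 : min X Y ≤ 0)
    (B1 : min p2 q12 ≤ p1) (B2 : min p1 q12 ≤ p2)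
    (C1 : min p2 q32 ≤ p3) (C2 : min p3 q32 ≤ p2)
    (D1 : min 0 (min d1 d2) ≤ q12) (D2 : min 0 (min d3 d1) ≤ q31)
    (D3 : min 0 (min d3 d2) ≤ q32)
    (O1 : Y + (p2 + q31) = p3 + q12) (O2 : X + (p2 + q31) = p1 + q32) :
    min 1 (max 0 X) + min 1 (max 0 Y) + min 1 (max 0 (-X)) ≤
      min 1 (max 0 p1) + min 1 (max 0 p2) + min 1 (max 0 p3) + max 0 q12 + max 0 q31 + max 0 q32
      + max 0 (-d1) + max 0 (-d2) + max 0 (-d3) := by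
  have L1 : min 1 (max 0 X) + min 1 (max 0 Y) + min 1 (max 0 (-X)) ≤ 1 := by
    clear B1 B2 C1 C2 D1 D2 D3 O1 O2
    omega
  have g1 : 0 ≤ min 1 (max 0 p1) := le_min zero_le_one (le_max_left _ _)
  have g2 : 0 ≤ min 1 (max 0 p2) := le_min zero_le_one (le_max_left _ _)
  have g3 : 0 ≤ min 1 (max 0 p3) := le_min zero_le_one (le_max_left _ _)
  have u1 := le_max_left 0 q12
  have u2 := le_max_left 0 q31
  have u3 := le_max_left 0 q32
  have v1 := le_max_right 0 q12
  have v2 := le_max_right 0 q31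
  have v3 := le_max_right 0 q32
  have w1 := le_max_left 0 (-d1)
  have w2 := le_max_left 0 (-d2)
  have w3 := le_max_left 0 (-d3)
  have x1 := le_max_right 0 (-d1)
  have x2 := le_max_right 0 (-d2)
  have x3 := le_max_right 0 (-d3)
  generalize max 0 q12 = Q1 at *
  generalize max 0 q31 = Q2 at *
  generalize max 0 q32 = Q3 at *
  generalize max 0 (-d1) = E1 at *
  generalize max 0 (-d2) = E2 at *
  generalize max 0 (-d3) = E3 at *
  by_cases hd1 : d1 < 0
  · linarith
  by_cases hd2 : d2 < 0
  · linarith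
  by_cases hd3 : d3 < 0
  · linarith
  by_cases hq1 : 0 < q12
  · linarith
  by_cases hq2 : 0 < q31
  · linarith
  by_cases hq3 : 0 < q32
  · linarith
  rw [min_eq_left (le_min (not_lt.1 hd1) (not_lt.1 hd2))] at D1
  rw [min_eq_left (le_min (not_lt.1 hd3) (not_lt.1 hd1))] at D2
  rw [min_eq_left (le_min (not_lt.1 hd3) (not_lt.1 hd2))] at D3
  have z1 : q12 = 0 := le_antisymm (not_lt.1 hq1) D1
  have z2 : q31 = 0 := le_antisymm (not_lt.1 hq2) D2
  have z3 : q32 = 0 := le_antisymm (not_lt.1 hq3) D3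
  subst z1 z2 z3
  have c : min 1 (max 0 X) + min 1 (max 0 Y) + min 1 (max 0 (-X)) ≤
      min 1 (max 0 p1) + min 1 (max 0 p2) + min 1 (max 0 p3) := by
    clear D1 D2 D3 u1 u2 u3 v1 v2 v3 w1 w2 w3 x1 x2 x3 hd1 hd2 hd3 hq1 hq2 hq3
    rcases lt_trichotomy X 0 with hX | hX | hX
    · have : 0 < p2 := by omega
      have e : min 1 (max 0 p2) = 1 := min_eq_left (le_max_of_le_right this)
      linarith
    · subst hX
      by_cases hY : 0 < Y
      · have : 0 < p3 := by omega
        have e : min 1 (max 0 p3) = 1 := min_eq_left (le_max_of_le_right this)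
        linarith
      · have e : min 1 (max 0 (0:ℤ)) + min 1 (max 0 Y) + min 1 (max 0 (-(0:ℤ))) = 0 := by
          simp; omega
        linarith
    · have : 0 < p1 := by omega
      have e : min 1 (max 0 p1) = 1 := min_eq_left (le_max_of_le_right this)
      linarith
  linarith

lemma pointwise {f1 a1 a2 a3 f2 : ℂ → ℂ} {z : ℂ} (hf1 : MeromorphicAt f1 z)
    (ha1 : MeromorphicAt a1 z) (ha2 : MeromorphicAt a2 z) (ha3 : MeromorphicAt a3 z)
    (hf2 : f2 = fun z =>
      ((f1 z - a1 z) / (f1 z - a2 z)) * ((a3 z - a2 z) / (a3 z - a1 z))) :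
    trunc 1 (zeroDiv f2 z) + trunc 1 (zeroDiv (fun z => f2 z - 1) z) + trunc 1 (poleDiv f2 z) ≤
      trunc 1 (zeroDiv (fun z => f1 z - a1 z) z) + trunc 1 (zeroDiv (fun z => f1 z - a2 z) z)
      + trunc 1 (zeroDiv (fun z => f1 z - a3 z) z) + zeroDiv (fun z => a1 z - a2 z) z
      + zeroDiv (fun z => a3 z - a1 z) z + zeroDiv (fun z => a3 z - a2 z) z
      + poleDiv a1 z + poleDiv a2 z + poleDiv a3 z := by
  simp only [trunc_one]
  have mP1 : MeromorphicAt (fun z => f1 z - a1 z) z := hf1.sub ha1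
  have mP2 : MeromorphicAt (fun z => f1 z - a2 z) z := hf1.sub ha2
  have mP3 : MeromorphicAt (fun z => f1 z - a3 z) z := hf1.sub ha3
  have mQ12 : MeromorphicAt (fun z => a1 z - a2 z) z := ha1.sub ha2
  have mQ31 : MeromorphicAt (fun z => a3 z - a1 z) z := ha3.sub ha1
  have mQ32 : MeromorphicAt (fun z => a3 z - a2 z) z := ha3.sub ha2
  have m2 : MeromorphicAt f2 z := by
    rw [hf2]; exact (mP1.div mP2).mul (mQ32.div mQ31)
  have m21 : MeromorphicAt (fun z => f2 z - 1) z := m2.sub (MeromorphicAt.const 1 z)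
  have triv : ∀ c : ℂ, f2 =ᶠ[𝓝[≠] z] (fun _ => c) →
    min 1 (zeroDiv f2 z) + min 1 (zeroDiv (fun z => f2 z - 1) z) + min 1 (poleDiv f2 z) ≤
      min 1 (zeroDiv (fun z => f1 z - a1 z) z) + min 1 (zeroDiv (fun z => f1 z - a2 z) z)
      + min 1 (zeroDiv (fun z => f1 z - a3 z) z) + zeroDiv (fun z => a1 z - a2 z) z
      + zeroDiv (fun z => a3 z - a1 z) z + zeroDiv (fun z => a3 z - a2 z) z
      + poleDiv a1 z + poleDiv a2 z + poleDiv a3 z := by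
    intro c hc
    have h1 := div_const hc
    have h2 : divisorAt (fun z => f2 z - 1) z = 0 := div_const (c := c - 1) (by
      filter_upwards [hc] with x hx
      rw [hx])
    have hL : min 1 (zeroDiv f2 z) + min 1 (zeroDiv (fun z => f2 z - 1) z)
        + min 1 (poleDiv f2 z) = 0 := by
      simp [zeroDiv, poleDiv, h1, h2]
    rw [hL]
    have hz : ∀ g : ℂ → ℂ, 0 ≤ zeroDiv g z := fun g => le_max_left _ _
    have hpo : ∀ g : ℂ → ℂ, 0 ≤ poleDiv g z := fun g => le_max_left _ _
    have hm : ∀ g : ℂ → ℂ, 0 ≤ min 1 (zeroDiv g z) := fun g => le_min zero_le_one (hz g)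
    repeat' apply add_nonneg
    all_goals first | exact hm _ | exact hz _ | exact hpo _
  by_cases t1 : meromorphicOrderAt (fun z => f1 z - a1 z) z = ⊤
  · refine triv 0 ?_
    filter_upwards [meromorphicOrderAt_eq_top_iff.1 t1] with x hx
    simp [hf2, hx]
  by_cases t2 : meromorphicOrderAt (fun z => f1 z - a2 z) z = ⊤
  · refine triv 0 ?_
    filter_upwards [meromorphicOrderAt_eq_top_iff.1 t2] with x hx
    simp [hf2, hx]
  by_cases t31 : meromorphicOrderAt (fun z => a3 z - a1 z) z = ⊤
  · refine triv 0 ?_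
    filter_upwards [meromorphicOrderAt_eq_top_iff.1 t31] with x hx
    simp [hf2, hx]
  by_cases t32 : meromorphicOrderAt (fun z => a3 z - a2 z) z = ⊤
  · refine triv 0 ?_
    filter_upwards [meromorphicOrderAt_eq_top_iff.1 t32] with x hx
    simp [hf2, hx]
  have n2 := (meromorphicOrderAt_ne_top_iff_eventually_ne_zero mP2).1 t2
  have n31 := (meromorphicOrderAt_ne_top_iff_eventually_ne_zero mQ31).1 t31
  have E1 : (fun z => f2 z - 1) * ((fun z => f1 z - a2 z) * (fun z => a3 z - a1 z))
      =ᶠ[𝓝[≠] z] (fun z => f1 z - a3 z) * (fun z => a1 z - a2 z) := by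
    filter_upwards [n2, n31] with x h1 h2
    simp only [Pi.mul_apply, hf2]
    field_simp
    ring
  have E2 : f2 * ((fun z => f1 z - a2 z) * (fun z => a3 z - a1 z))
      =ᶠ[𝓝[≠] z] (fun z => f1 z - a1 z) * (fun z => a3 z - a2 z) := by
    filter_upwards [n2, n31] with x h1 h2
    simp only [Pi.mul_apply, hf2]
    field_simp
  by_cases t3 : meromorphicOrderAt (fun z => f1 z - a3 z) z = ⊤
  · refine triv 1 ?_
    filter_upwards [meromorphicOrderAt_eq_top_iff.1 t3, E1, n2, n31] with x hx h1 h2 h3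
    simp only [Pi.mul_apply, hx, zero_mul, mul_eq_zero, h2, h3, or_false] at h1
    exact sub_eq_zero.1 h1
  by_cases t12 : meromorphicOrderAt (fun z => a1 z - a2 z) z = ⊤
  · refine triv 1 ?_
    filter_upwards [meromorphicOrderAt_eq_top_iff.1 t12, E1, n2, n31] with x hx h1 h2 h3
    simp only [Pi.mul_apply, hx, mul_zero, mul_eq_zero, h2, h3, or_false] at h1
    exact sub_eq_zero.1 h1
  clear triv
  obtain ⟨p1, hp1⟩ := WithTop.ne_top_iff_exists.1 t1
  obtain ⟨p2, hp2⟩ := WithTop.ne_top_iff_exists.1 t2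
  obtain ⟨p3, hp3⟩ := WithTop.ne_top_iff_exists.1 t3
  obtain ⟨q12, hq12⟩ := WithTop.ne_top_iff_exists.1 t12
  obtain ⟨q31, hq31⟩ := WithTop.ne_top_iff_exists.1 t31
  obtain ⟨q32, hq32⟩ := WithTop.ne_top_iff_exists.1 t32
  have O1 := meromorphicOrderAt_congr E1
  have O2 := meromorphicOrderAt_congr E2
  rw [meromorphicOrderAt_mul m21 (mP2.mul mQ31), meromorphicOrderAt_mul mP2 mQ31,
    meromorphicOrderAt_mul mP3 mQ12, ← hp2, ← hq31, ← hp3, ← hq12] at O1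
  rw [meromorphicOrderAt_mul m2 (mP2.mul mQ31), meromorphicOrderAt_mul mP2 mQ31,
    meromorphicOrderAt_mul mP1 mQ32, ← hp2, ← hq31, ← hp1, ← hq32] at O2
  have tX : meromorphicOrderAt f2 z ≠ ⊤ := by
    intro h; rw [h, top_add] at O2
    exact absurd O2.symm (by norm_cast)
  have tY : meromorphicOrderAt (fun z => f2 z - 1) z ≠ ⊤ := by
    intro h; rw [h, top_add] at O1
    exact absurd O1.symm (by norm_cast)
  obtain ⟨X, hX⟩ := WithTop.ne_top_iff_exists.1 tX
  obtain ⟨Y, hY⟩ := WithTop.ne_top_iff_exists.1 tY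
  rw [← hY] at O1
  rw [← hX] at O2
  norm_cast at O1 O2
  have m1 : MeromorphicAt (fun _ : ℂ => (1:ℂ)) z := MeromorphicAt.const 1 z
  have h1 : meromorphicOrderAt (fun _ : ℂ => (1:ℂ)) z = ((0:ℤ) : WithTop ℤ) := by
    rw [meromorphicOrderAt_const, if_neg one_ne_zero]; rfl
  have hm : (-1 : ℂ) ≠ 0 := by simp
  have ho : (1 : ℂ) ≠ 0 := one_ne_zero
  have A1 := ord3 m2 m1 ho hm (fun x => by ring) hX.symm h1 hY.symm
  have A2 := ord3 (w := f2) m21 m1 ho ho (fun x => by ring) hY.symm h1 hX.symm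
  have A3 := ord3 (w := fun _ => (1:ℂ)) m2 m21 ho hm (fun x => by ring) hX.symm hY.symm h1
  have B1 := ord3 mP2 mQ12 ho hm (fun x => by ring) hp2.symm hq12.symm hp1.symm
  have B2 := ord3 mP1 mQ12 ho ho (fun x => by ring) hp1.symm hq12.symm hp2.symm
  have B3 := ord3 mP1 mP2 hm ho (fun x => by ring) hp1.symm hp2.symm hq12.symm
  have C1 := ord3 mP2 mQ32 ho hm (fun x => by ring) hp2.symm hq32.symm hp3.symm
  have C2 := ord3 mP3 mQ32 ho ho (fun x => by ring) hp3.symm hq32.symm hp2.symm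
  have C3 := ord3 mP2 mP3 ho hm (fun x => by ring) hp2.symm hp3.symm hq32.symm
  have D1 := pole_sub ha1 ha2
  have D2 := pole_sub ha3 ha1
  have D3 := pole_sub ha3 ha2
  have e1 : divisorAt (fun z => f1 z - a1 z) z = p1 := by rw [divisorAt_eq _ _ mP1, ← hp1]; rfl
  have e2 : divisorAt (fun z => f1 z - a2 z) z = p2 := by rw [divisorAt_eq _ _ mP2, ← hp2]; rfl
  have e3 : divisorAt (fun z => f1 z - a3 z) z = p3 := by rw [divisorAt_eq _ _ mP3, ← hp3]; rfl
  have e12 : divisorAt (fun z => a1 z - a2 z) z = q12 := by rw [divisorAt_eq _ _ mQ12, ← hq12]; rfl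
  have e31 : divisorAt (fun z => a3 z - a1 z) z = q31 := by rw [divisorAt_eq _ _ mQ31, ← hq31]; rfl
  have e32 : divisorAt (fun z => a3 z - a2 z) z = q32 := by rw [divisorAt_eq _ _ mQ32, ← hq32]; rfl
  have eX : divisorAt f2 z = X := by rw [divisorAt_eq _ _ m2, ← hX]; rfl
  have eY : divisorAt (fun z => f2 z - 1) z = Y := by rw [divisorAt_eq _ _ m21, ← hY]; rfl
  rw [e12] at D1
  rw [e31] at D2
  rw [e32] at D3
  simp only [zeroDiv, poleDiv, e1, e2, e3, e12, e31, e32, eX, eY]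
  generalize divisorAt a1 z = d1 at *
  generalize divisorAt a2 z = d2 at *
  generalize divisorAt a3 z = d3 at *
  clear e1 e2 e3 e12 e31 e32 eX eY
  exact int_core A1 A2 A3 B1 B2 C1 C2 D1 D2 D3 O1 O2

lemma KK_sub {R0 : ℝ≥0∞} {ρ : ℝ} (h1 : 1 < ρ) (h : ENNReal.ofReal ρ < R0) :
    KK ρ ⊆ Annulus R0 := by
  intro z hz
  have hρ : 0 < ρ := by linarith
  have e : (‖z‖₊ : ℝ≥0∞) = ENNReal.ofReal ‖z‖ := (ofReal_norm_eq_enorm z).symm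
  refine ⟨?_, ?_⟩
  · rw [e]
    calc R0⁻¹ < (ENNReal.ofReal ρ)⁻¹ := ENNReal.inv_lt_inv.2 h
      _ = ENNReal.ofReal (ρ⁻¹) := (ENNReal.ofReal_inv_of_pos hρ).symm
      _ ≤ _ := ENNReal.ofReal_le_ofReal (by have := hz.1; rwa [one_div] at this)
  · rw [e]
    exact (ENNReal.ofReal_le_ofReal hz.2).trans_lt h

lemma precon (R0 : ℝ≥0∞) : IsPreconnected (Annulus R0) := by
  set S : Set ℝ := {x | R0⁻¹ < ENNReal.ofReal (Real.exp x) ∧ ENNReal.ofReal (Real.exp x) < R0}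
    with hS
  have hconv : Convex ℝ S := by
    have : S.OrdConnected := by
      refine ⟨?_⟩
      intro x hx y hy w hw
      exact ⟨hx.1.trans_le (ENNReal.ofReal_le_ofReal (Real.exp_le_exp.2 hw.1)),
        (ENNReal.ofReal_le_ofReal (Real.exp_le_exp.2 hw.2)).trans_lt hy.2⟩
    exact this.convex
  have h2 : IsPreconnected (Complex.re ⁻¹' S) :=
    (hconv.linear_preimage Complex.reLm).isPreconnected
  have h3 := h2.image Complex.exp Complex.continuous_exp.continuousOn
  have e : ∀ z : ℂ, (‖z‖₊ : ℝ≥0∞) = ENNReal.ofReal ‖z‖ := fun z => (ofReal_norm_eq_enorm z).symm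
  convert h3 using 1
  ext z
  constructor
  · intro hz
    have hz0 : z ≠ 0 := by
      rintro rfl
      have := hz.1
      simp at this
    refine ⟨Complex.log z, ?_, Complex.exp_log hz0⟩
    have : Real.exp (Complex.log z).re = ‖z‖ := by
      rw [Complex.log_re, Real.exp_log (norm_pos_iff.2 hz0)]
    change R0⁻¹ < ENNReal.ofReal (Real.exp (Complex.log z).re) ∧
      ENNReal.ofReal (Real.exp (Complex.log z).re) < R0
    rw [this, ← e]
    exact hz
  · rintro ⟨w, hw, rfl⟩
    change R0⁻¹ < (‖Complex.exp w‖₊ : ℝ≥0∞) ∧ (‖Complex.exp w‖₊ : ℝ≥0∞) < R0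
    rw [e, Complex.norm_exp]
    exact hw

lemma circleAvg_eq (f : ℂ → ℂ) (t : ℝ) :
    circleAvg f t = Real.circleAverage (fun z => Real.posLog ‖f z‖) 0 t := by
  rw [circleAvg, Real.circleAverage, smul_eq_mul, one_div]
  congr 1
  apply intervalIntegral.integral_congr
  intro θ _
  simp only [circleMap, zero_add, Real.posLog_def, logPos]
  rfl

lemma circleAvg_nonneg (f : ℂ → ℂ) (t : ℝ) : 0 ≤ circleAvg f t := by
  rw [circleAvg_eq]
  apply Real.circleAverage_nonneg_of_nonneg
  intro z _
  exact Real.posLog_nonneg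

lemma circleAvg_sub {a b : ℂ → ℂ} {t : ℝ} (ha : MeromorphicOn a (Metric.sphere 0 |t|))
    (hb : MeromorphicOn b (Metric.sphere 0 |t|)) :
    circleAvg (fun z => a z - b z) t ≤ circleAvg a t + circleAvg b t + Real.log 2 := by
  have ia := ha.circleIntegrable_posLog_norm
  have ib := hb.circleIntegrable_posLog_norm
  have iab := (ha.sub hb).circleIntegrable_posLog_norm
  have ic : CircleIntegrable (fun _ : ℂ => Real.log 2) 0 t := circleIntegrable_const _ _ _
  rw [circleAvg_eq, circleAvg_eq, circleAvg_eq]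
  have h1 := Real.circleAverage_add ia ib
  have h2 := Real.circleAverage_add (ia.add ib) ic
  rw [h1, Real.circleAverage_const] at h2
  refine le_trans ?_ h2.le
  apply Real.circleAverage_mono iab ((ia.add ib).add ic)
  intro x _
  have := Real.posLog_norm_add_le (a x) (-b x)
  rw [norm_neg] at this
  simp only [Pi.add_apply]
  have e : a x - b x = a x + -b x := sub_eq_add_neg _ _
  change Real.posLog ‖a x - b x‖ ≤ _
  rw [e]
  linarith

lemma sphere_sub {r ρ t : ℝ} (hr : 1 ≤ r) (hrρ : r < ρ) (ht : t = r ∨ t = 1 / r) :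
    Metric.sphere (0:ℂ) |t| ⊆ KK ρ := by
  intro z hz
  have hr0 : 0 < r := by linarith
  have hz' : ‖z‖ = |t| := by simpa using hz
  have h1 : 1 / ρ ≤ 1 / r := one_div_le_one_div_of_le hr0 hrρ.le
  have h2 : 1 / r ≤ 1 := by rw [div_le_one hr0]; exact hr
  have ht0 : 0 < t := by
    rcases ht with rfl | rfl
    · exact hr0
    · positivity
  rw [abs_of_pos ht0] at hz'
  refine ⟨?_, ?_⟩ <;> rw [hz'] <;> rcases ht with rfl | rfl <;> linarith

lemma zero_bound {R0 : ℝ≥0∞} {g : ℂ → ℂ} (hg : MeromorphicOn g (Annulus R0)) :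
    ∃ C : ℝ, ∀ (r ρ : ℝ) (F : Finset ℂ), 1 ≤ r → r < ρ → KK ρ ⊆ Annulus R0 →
      (∀ z ∈ F, z ∈ KK ρ) → (∀ z ∈ KK ρ, z ∉ F → divisorAt g z = 0) →
      ∑ z ∈ F, (zeroDiv g z : ℝ) * kern r z ≤ circleAvg g r + circleAvg g (1 / r)
        + ∑ z ∈ F, (poleDiv g z : ℝ) * kern r z + C := by
  by_cases hd : ∃ z ∈ Annulus R0, meromorphicOrderAt g z ≠ ⊤
  · obtain ⟨z0, hz0, hz0'⟩ := hd
    have hne : ∀ u ∈ Annulus R0, meromorphicOrderAt g u ≠ ⊤ := fun u hu =>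
      hg.meromorphicOrderAt_ne_top_of_isPreconnected (precon R0) hz0 hu hz0'
    refine ⟨|2 * Real.circleAverage (fun z => Real.log ‖g z‖) 0 1|, ?_⟩
    intro r ρ F hr hrρ hK hF hF'
    have hgK : MeromorphicOn g (KK ρ) := fun z hz => hg z (hK hz)
    have J := jensen (lt_of_le_of_lt hr hrρ) hgK (fun u hu => hne u (hK hu)) hr hrρ F hF hF'
    have key : ∀ t, (t = r ∨ t = 1 / r) →
        Real.circleAverage (fun z => Real.log ‖g z‖) 0 t ≤ circleAvg g t := by
      intro t ht
      have hs : MeromorphicOn g (Metric.sphere 0 |t|) := fun z hz => hgK z (sphere_sub hr hrρ ht hz)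
      rw [circleAvg_eq]
      apply Real.circleAverage_mono hs.circleIntegrable_log_norm hs.circleIntegrable_posLog_norm
      intro x _
      rw [Real.posLog_def]
      exact le_max_right _ _
    have k1 := key r (Or.inl rfl)
    have k2 := key (1 / r) (Or.inr rfl)
    have k3 := neg_abs_le (2 * Real.circleAverage (fun z => Real.log ‖g z‖) 0 1)
    have e : ∑ u ∈ F, (divisorAt g u : ℝ) * kern r u
        = ∑ z ∈ F, (zeroDiv g z : ℝ) * kern r z - ∑ z ∈ F, (poleDiv g z : ℝ) * kern r z := by
      rw [← Finset.sum_sub_distrib]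
      apply Finset.sum_congr rfl
      intro z _
      have : divisorAt g z = zeroDiv g z - poleDiv g z := by
        simp only [zeroDiv, poleDiv]; omega
      rw [this]; push_cast; ring
    linarith
  · push Not at hd
    refine ⟨0, ?_⟩
    intro r ρ F hr hrρ hK hF hF'
    have z0 : ∀ z ∈ F, divisorAt g z = 0 := by
      intro z hz
      have hz' := hK (hF z hz)
      rw [divisorAt_eq g z (hg z hz'), hd z hz']
      rfl
    have e1 : ∑ z ∈ F, (zeroDiv g z : ℝ) * kern r z = 0 := by
      apply Finset.sum_eq_zero
      intro z hz
      simp [zeroDiv, z0 z hz]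
    have e2 : ∑ z ∈ F, (poleDiv g z : ℝ) * kern r z = 0 := by
      apply Finset.sum_eq_zero
      intro z hz
      simp [poleDiv, z0 z hz]
    rw [e1, e2]
    have := circleAvg_nonneg g r
    have := circleAvg_nonneg g (1 / r)
    linarith

/-- Combined bound for differences. -/
lemma diff_bound {R0 : ℝ≥0∞} {a b : ℂ → ℂ} (ha : MeromorphicOn a (Annulus R0))
    (hb : MeromorphicOn b (Annulus R0)) :
    ∃ C : ℝ, ∀ (r ρ : ℝ) (F : Finset ℂ), 1 ≤ r → r < ρ → KK ρ ⊆ Annulus R0 →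
      (∀ z ∈ F, z ∈ KK ρ) → (∀ z ∈ KK ρ, z ∉ F → divisorAt (fun z => a z - b z) z = 0) →
      ∑ z ∈ F, (zeroDiv (fun z => a z - b z) z : ℝ) * kern r z ≤
        (circleAvg a r + circleAvg a (1 / r) + ∑ z ∈ F, (poleDiv a z : ℝ) * kern r z)
        + (circleAvg b r + circleAvg b (1 / r) + ∑ z ∈ F, (poleDiv b z : ℝ) * kern r z) + C := by
  have hab : MeromorphicOn (fun z => a z - b z) (Annulus R0) := ha.sub hb
  obtain ⟨C, hC⟩ := zero_bound hab
  refine ⟨C + 2 * Real.log 2, ?_⟩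
  intro r ρ F hr hrρ hK hF hF'
  have h := hC r ρ F hr hrρ hK hF hF'
  have s : ∀ t, (t = r ∨ t = 1 / r) → Metric.sphere (0:ℂ) |t| ⊆ Annulus R0 :=
    fun t ht => (sphere_sub hr hrρ ht).trans hK
  have s1 := circleAvg_sub (fun z hz => ha z (s r (Or.inl rfl) hz))
    (fun z hz => hb z (s r (Or.inl rfl) hz))
  have s2 := circleAvg_sub (fun z hz => ha z (s (1/r) (Or.inr rfl) hz))
    (fun z hz => hb z (s (1/r) (Or.inr rfl) hz))
  have p : ∑ z ∈ F, (poleDiv (fun z => a z - b z) z : ℝ) * kern r z ≤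
      ∑ z ∈ F, (poleDiv a z : ℝ) * kern r z + ∑ z ∈ F, (poleDiv b z : ℝ) * kern r z := by
    rw [← Finset.sum_add_distrib]
    apply Finset.sum_le_sum
    intro z hz
    rw [← add_mul]
    apply mul_le_mul_of_nonneg_right _ (kern_nonneg r z)
    have := poleDiv_sub (ha z (hK (hF z hz))) (hb z (hK (hF z hz)))
    exact_mod_cast this
  linarith

lemma T0_eq {a : ℂ → ℂ} {r ρ : ℝ} (hr : 1 ≤ r) (hrρ : r < ρ) {F : Finset ℂ}
    (h0 : ∀ z ∈ F, z ≠ 0) (hF' : ∀ z ∈ KK r, z ∉ F → divisorAt a z = 0) :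
    T0 a r = circleAvg a r + circleAvg a (1 / r) - 2 * circleAvg a 1
      + ∑ z ∈ F, (poleDiv a z : ℝ) * kern r z := by
  rw [T0, m0, N0_eq hr h0 (fun z hz hzF => by simp [trunc_top, poleDiv, hF' z hz hzF])]
  simp only [trunc_top]

lemma N0z_eq {a : ℂ → ℂ} {r : ℝ} (hr : 1 ≤ r) {F : Finset ℂ}
    (h0 : ∀ z ∈ F, z ≠ 0) (hF' : ∀ z ∈ KK r, z ∉ F → divisorAt a z = 0) :
    N0 1 (zeroDiv a) r = ∑ z ∈ F, (trunc 1 (zeroDiv a z) : ℝ) * kern r z :=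
  N0_eq hr h0 (fun z hz hzF => by simp [trunc_one, zeroDiv, hF' z hz hzF])

lemma N0p_eq {a : ℂ → ℂ} {r : ℝ} (hr : 1 ≤ r) {F : Finset ℂ}
    (h0 : ∀ z ∈ F, z ≠ 0) (hF' : ∀ z ∈ KK r, z ∉ F → divisorAt a z = 0) :
    N0 1 (poleDiv a) r = ∑ z ∈ F, (trunc 1 (poleDiv a z) : ℝ) * kern r z :=
  N0_eq hr h0 (fun z hz hzF => by simp [trunc_one, poleDiv, hF' z hz hzF])

lemma exists_F {ρ : ℝ} (hρ : 1 < ρ) {L : List (ℂ → ℂ)} (hL : ∀ g ∈ L, MeromorphicOn g (KK ρ)) :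
    ∃ F : Finset ℂ, (∀ z ∈ F, z ∈ KK ρ) ∧
      ∀ g ∈ L, ∀ z ∈ KK ρ, z ∉ F → divisorAt g z = 0 := by
  induction L with
  | nil => exact ⟨∅, by simp, by simp⟩
  | cons g L ih =>
    obtain ⟨F, h1, h2⟩ := ih (fun g hg => hL g (List.mem_cons_of_mem _ hg))
    have hfin := finite_div (hL g List.mem_cons_self)
    refine ⟨F ∪ hfin.toFinset, ?_, ?_⟩
    · intro z hz
      rcases Finset.mem_union.1 hz with h | h
      · exact h1 z h
      · exact (hfin.mem_toFinset.1 h).1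
    · intro k hk z hz hzF
      rw [Finset.mem_union, not_or] at hzF
      rcases List.mem_cons.1 hk with rfl | hk
      · by_contra hne
        exact hzF.2 (hfin.mem_toFinset.2 ⟨hz, hne⟩)
      · exact h2 k hk z hz hzF.1
/-- Lemma 3.2 (b): for `f₂ = ((f₁-a₁)/(f₁-a₂))·((a₃-a₂)/(a₃-a₁))` one has
`N̄₀(r, ν⁰_{f₂}) + N̄₀(r, ν⁰_{f₂-1}) + N̄₀(r, ν^∞_{f₂})
  ≤ ∑_{i=1}^3 (N̄₀(r, ν⁰_{f₁-aᵢ}) + 3 T₀(r, aᵢ)) + O(1)` for `1 ≤ r < R₀`. -/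
theorem lemma32b
    (R0 : ℝ≥0∞) (hR0 : 1 < R0)
    (f1 a1 a2 a3 : ℂ → ℂ)
    (hf1 : MeromorphicOn f1 (Annulus R0))
    (ha1 : MeromorphicOn a1 (Annulus R0)) (ha2 : MeromorphicOn a2 (Annulus R0))
    (ha3 : MeromorphicOn a3 (Annulus R0))
    (h12 : ¬ Set.EqOn a1 a2 (Annulus R0))
    (h13 : ¬ Set.EqOn a1 a3 (Annulus R0))
    (h23 : ¬ Set.EqOn a2 a3 (Annulus R0))
    (hfa1 : ¬ Set.EqOn f1 a1 (Annulus R0))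
    (hfa2 : ¬ Set.EqOn f1 a2 (Annulus R0))
    (hfa3 : ¬ Set.EqOn f1 a3 (Annulus R0))
    (f2 : ℂ → ℂ)
    (hf2 : f2 = fun z =>
      ((f1 z - a1 z) / (f1 z - a2 z)) * ((a3 z - a2 z) / (a3 z - a1 z))) :
    ∃ C : ℝ, ∀ r : ℝ, 1 ≤ r → ENNReal.ofReal r < R0 →
      N0 1 (zeroDiv f2) r + N0 1 (zeroDiv (fun z => f2 z - 1)) r
          + N0 1 (poleDiv f2) r ≤
        (N0 1 (zeroDiv (fun z => f1 z - a1 z)) r + 3 * T0 a1 r)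
          + (N0 1 (zeroDiv (fun z => f1 z - a2 z)) r + 3 * T0 a2 r)
          + (N0 1 (zeroDiv (fun z => f1 z - a3 z)) r + 3 * T0 a3 r) + C := by
  have mQ12 : MeromorphicOn (fun z => a1 z - a2 z) (Annulus R0) := ha1.sub ha2
  have mQ31 : MeromorphicOn (fun z => a3 z - a1 z) (Annulus R0) := ha3.sub ha1
  have mQ32 : MeromorphicOn (fun z => a3 z - a2 z) (Annulus R0) := ha3.sub ha2
  have mP1 : MeromorphicOn (fun z => f1 z - a1 z) (Annulus R0) := hf1.sub ha1
  have mP2 : MeromorphicOn (fun z => f1 z - a2 z) (Annulus R0) := hf1.sub ha2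
  have mP3 : MeromorphicOn (fun z => f1 z - a3 z) (Annulus R0) := hf1.sub ha3
  have m2 : MeromorphicOn f2 (Annulus R0) := by
    rw [hf2]; exact (mP1.div mP2).mul (mQ32.div mQ31)
  have m21 : MeromorphicOn (fun z => f2 z - 1) (Annulus R0) :=
    fun z hz => (m2 z hz).sub (MeromorphicAt.const 1 z)
  obtain ⟨C1, hC1⟩ := diff_bound ha1 ha2
  obtain ⟨C2, hC2⟩ := diff_bound ha3 ha1
  obtain ⟨C3, hC3⟩ := diff_bound ha3 ha2
  refine ⟨C1 + C2 + C3 + 6 * (circleAvg a1 1 + circleAvg a2 1 + circleAvg a3 1), ?_⟩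
  intro r hr hrR
  obtain ⟨ρ, hrρ, hρR⟩ : ∃ ρ : ℝ, r < ρ ∧ ENNReal.ofReal ρ < R0 := by
    obtain ⟨q, hq1, hq2⟩ := ENNReal.lt_iff_exists_nnreal_btwn.1 hrR
    refine ⟨q, ?_, by rwa [ENNReal.ofReal_coe_nnreal]⟩
    exact ((ENNReal.ofReal_lt_coe_iff (by linarith)).1 hq1)
  have hρ : 1 < ρ := by linarith
  have hK := KK_sub hρ hρR
  have hKr : KK r ⊆ KK ρ := fun z hz =>
    ⟨(one_div_le_one_div_of_le (by linarith) hrρ.le).trans hz.1, hz.2.trans hrρ.le⟩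
  obtain ⟨F, hF, hF'⟩ := exists_F hρ (L := [f2, fun z => f2 z - 1, fun z => f1 z - a1 z,
    fun z => f1 z - a2 z, fun z => f1 z - a3 z, fun z => a1 z - a2 z, fun z => a3 z - a1 z,
    fun z => a3 z - a2 z, a1, a2, a3]) (by
      simp only [List.forall_mem_cons]
      exact ⟨m2.mono_set hK, m21.mono_set hK, mP1.mono_set hK, mP2.mono_set hK, mP3.mono_set hK,
        mQ12.mono_set hK, mQ31.mono_set hK, mQ32.mono_set hK, ha1.mono_set hK, ha2.mono_set hK,
        ha3.mono_set hK, by simp⟩)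
  simp only [List.forall_mem_cons] at hF'
  obtain ⟨g1, g2, g3, g4, g5, g6, g7, g8, g9, g10, g11, -⟩ := hF'
  have h0 : ∀ z ∈ F, z ≠ 0 := by
    rintro z hz rfl
    have h := (hF 0 hz).1
    rw [norm_zero] at h
    have : 0 < 1 / ρ := by positivity
    linarith
  have d1 := hC1 r ρ F hr hrρ hK hF g6
  have d2 := hC2 r ρ F hr hrρ hK hF g7
  have d3 := hC3 r ρ F hr hrρ hK hF g8
  rw [N0z_eq hr h0 (fun z hz => g1 z (hKr hz)), N0z_eq hr h0 (fun z hz => g2 z (hKr hz)),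
    N0p_eq hr h0 (fun z hz => g1 z (hKr hz)), N0z_eq hr h0 (fun z hz => g3 z (hKr hz)),
    N0z_eq hr h0 (fun z hz => g4 z (hKr hz)), N0z_eq hr h0 (fun z hz => g5 z (hKr hz)),
    T0_eq hr hrρ h0 (fun z hz => g9 z (hKr hz)), T0_eq hr hrρ h0 (fun z hz => g10 z (hKr hz)),
    T0_eq hr hrρ h0 (fun z hz => g11 z (hKr hz))]
  have main := Finset.sum_le_sum (s := F) (fun z hz => mul_le_mul_of_nonneg_right
    (Int.cast_le (R := ℝ).2 (pointwise (hf1 z (hK (hF z hz))) (ha1 z (hK (hF z hz)))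
      (ha2 z (hK (hF z hz))) (ha3 z (hK (hF z hz))) hf2)) (kern_nonneg r z))
  simp only [Int.cast_add, add_mul, Finset.sum_add_distrib] at main
  have q1 := circleAvg_nonneg a1 r
  have q2 := circleAvg_nonneg a2 r
  have q3 := circleAvg_nonneg a3 r
  have q4 := circleAvg_nonneg a1 (1 / r)
  have q5 := circleAvg_nonneg a2 (1 / r)
  have q6 := circleAvg_nonneg a3 (1 / r)
  linarith

end
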